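/- arXiv:1902.10587 — 2 statements merged into one kernel-verified Lean document; each statement's English description precedes it below -/
import Mathlib

section
/- For n ≥ 2, k > 1, and λ ∈ (0,1), the first eigenvalue μ_{k,1}(λ) = 2D/(C + √(C²-4λD)) - 1/c_λ, where α = n/2+k-1, ω = -α log λ, C = α(λ+1)coth ω + (n/2)(λ-1), D = (n+k-1)(k-1), and 1/c_λ = n(1+λ^{n-1})/(1-λⁿ), is a strictly decreasing function of λ on (0,1). -/
/-- The hyperbolic cotangent exceeds `1` on the positive half-line. -/
lemma one_lt_cosh_div_sinh {x : ℝ} (hx : 0 < x) : 1 < Real.cosh x / Real.sinh x := by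
  rw [one_lt_div (Real.sinh_pos_iff.2 hx)]
  exact Real.sinh_lt_cosh x

/-- The hyperbolic cotangent is strictly decreasing on the positive half-line. -/
lemma cosh_div_sinh_lt {x y : ℝ} (hx : 0 < x) (hxy : x < y) :
    Real.cosh y / Real.sinh y < Real.cosh x / Real.sinh x := by
  rw [div_lt_div_iff₀ (Real.sinh_pos_iff.2 (hx.trans hxy)) (Real.sinh_pos_iff.2 hx)]
  have h : 0 < Real.sinh (y - x) := Real.sinh_pos_iff.2 (sub_pos.2 hxy)
  rw [Real.sinh_sub] at h
  linarith

/-- Where the quadratic `l x² - c x + d` is negative, `x` exceeds its smaller root. -/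
lemma smaller_root_lt_of_neg {l c d x : ℝ} (hl : 0 < l) (hc : 0 < c)
    (h : l * x ^ 2 - c * x + d < 0) : 2 * d / (c + √(c ^ 2 - 4 * l * d)) < x := by
  have hdisc : 0 ≤ c ^ 2 - 4 * l * d := by nlinarith [sq_nonneg (2 * l * x - c)]
  have hs := Real.sqrt_nonneg (c ^ 2 - 4 * l * d)
  have hsq := Real.sq_sqrt hdisc
  set s := √(c ^ 2 - 4 * l * d)
  rw [div_lt_iff₀ (by positivity)]
  have habs : |2 * l * x - c| < s := abs_lt_of_sq_lt_sq (by nlinarith) hs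
  have hlow := (abs_lt.1 habs).1
  have hmul : 0 < (2 * l * x - c + s) * (c + s) := mul_pos (by linarith) (by positivity)
  have : 0 < 2 * l * (x * (c + s) - 2 * d) := by linarith
  have := pos_of_mul_pos_right this (by positivity)
  linarith

/-- The rationalized expression for the smaller root is a root of `l x² - c x + d`. -/
lemma smaller_root_isRoot {l c d : ℝ} (hc : 0 < c) (hdisc : 0 ≤ c ^ 2 - 4 * l * d) :
    l * (2 * d / (c + √(c ^ 2 - 4 * l * d))) ^ 2 - c * (2 * d / (c + √(c ^ 2 - 4 * l * d))) + d
      = 0 := by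
  have hs := Real.sqrt_nonneg (c ^ 2 - 4 * l * d)
  have hsq := Real.sq_sqrt hdisc
  set s := √(c ^ 2 - 4 * l * d)
  have hne : c + s ≠ 0 := by positivity
  field_simp
  linear_combination d * hsq

/-- The reciprocal of the Neumann constant of the annulus is increasing in the inner radius. -/
lemma mul_one_add_pow_div_le {n : ℕ} (hn : n ≠ 0) {x y : ℝ} (hx : 0 ≤ x) (hxy : x ≤ y)
    (hy : y < 1) :
    n * (1 + x ^ (n - 1)) / (1 - x ^ n) ≤ n * (1 + y ^ (n - 1)) / (1 - y ^ n) := by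
  have hy0 : 0 ≤ y := hx.trans hxy
  have : 0 < 1 - y ^ n := sub_pos.2 (pow_lt_one₀ hy0 hy hn)
  gcongr

theorem stmt8 (n : ℕ) (hn : 2 ≤ n) (k : ℝ) (hk : 1 < k) (α : ℝ) (hα : α = n/2 + k - 1)
    (C : ℝ → ℝ)
    (hC : ∀ l : ℝ, C l = α * (l + 1) * (Real.cosh (-α * Real.log l) / Real.sinh (-α * Real.log l)) + (n/2) * (l - 1))
    (D : ℝ) (hD : D = (n + k - 1) * (k - 1)) :
    StrictAntiOn (fun l : ℝ => 2*D / (C l + Real.sqrt ((C l)^2 - 4*l*D))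
      - n * (1 + l^(n-1)) / (1 - l^n)) (Set.Ioo 0 1) := by
  have hn0 : (0 : ℝ) ≤ n := n.cast_nonneg
  have hα0 : 0 < α := by rw [hα]; linarith
  have hk1 : 0 < k - 1 := by linarith
  have hD0 : 0 < D := by rw [hD]; exact mul_pos (by linarith) hk1
  -- `E` is the deviation of `C` from its value with `coth` replaced by `1`, for which the
  -- quadratic `l x² - C x + D` factors with roots `n + k - 1` and `(k - 1) / l`.
  set E : ℝ → ℝ := fun l =>
    α * (l + 1) * (Real.cosh (-α * Real.log l) / Real.sinh (-α * Real.log l) - 1) with hE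
  have hCE (l : ℝ) : C l = (k - 1) + l * (n + k - 1) + E l := by
    simp only [hC, hE]
    linear_combination (l + 1) * hα
  have hω {l : ℝ} (h : l ∈ Set.Ioo (0 : ℝ) 1) : 0 < -α * Real.log l :=
    mul_pos_of_neg_of_neg (neg_neg_of_pos hα0) (Real.log_neg h.1 h.2)
  have hEpos {l : ℝ} (h : l ∈ Set.Ioo (0 : ℝ) 1) : 0 < E l := by
    have := h.1
    exact mul_pos (by positivity) (sub_pos.2 (one_lt_cosh_div_sinh (hω h)))
  have hCpos {l : ℝ} (h : l ∈ Set.Ioo (0 : ℝ) 1) : 0 < C l := by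
    rw [hCE]
    have := hEpos h
    have : 0 < l * (n + k - 1) := mul_pos h.1 (by linarith)
    linarith
  have hneg {l : ℝ} (h : l ∈ Set.Ioo (0 : ℝ) 1) :
      l * (n + k - 1) ^ 2 - C l * (n + k - 1) + D < 0 := by
    have : 0 < E l * (n + k - 1) := mul_pos (hEpos h) (by linarith)
    rw [hCE, hD]
    linarith
  intro x hx y hy hxy
  have hEmono : E x < E y := by
    have hlog : -α * Real.log y < -α * Real.log x :=
      mul_lt_mul_of_neg_left (Real.log_lt_log hx.1 hxy) (neg_neg_of_pos hα0)
    have hcoth := cosh_div_sinh_lt (hω hy) hlog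
    have hone := one_lt_cosh_div_sinh (hω hx)
    have := hx.1
    have := hy.1
    exact mul_lt_mul'' (by gcongr) (by linarith) (by positivity) (by linarith)
  have hlt := smaller_root_lt_of_neg hx.1 (hCpos hx) (hneg hx)
  have hdisc : 0 ≤ C x ^ 2 - 4 * x * D := by
    nlinarith [sq_nonneg (2 * x * (n + k - 1) - C x), mul_pos_of_neg_of_neg
      (neg_neg_of_pos hx.1) (hneg hx)]
  have hroot := smaller_root_isRoot (hCpos hx) hdisc
  have hpos : 0 < 2 * D / (C x + √(C x ^ 2 - 4 * x * D)) := by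
    have := hCpos hx
    positivity
  have hρ : 2 * D / (C y + √(C y ^ 2 - 4 * y * D))
      < 2 * D / (C x + √(C x ^ 2 - 4 * x * D)) := by
    refine smaller_root_lt_of_neg hy.1 (hCpos hy) ?_
    set r := 2 * D / (C x + √(C x ^ 2 - 4 * x * D))
    rw [hCE] at hroot ⊢
    have h₁ : 0 < (y - x) * r * (n + k - 1 - r) :=
      mul_pos (mul_pos (sub_pos.2 hxy) hpos) (sub_pos.2 hlt)
    have h₂ : 0 < (E y - E x) * r := mul_pos (sub_pos.2 hEmono) hpos
    linarith
  have hc := mul_one_add_pow_div_le (n := n) (by lia) hx.1.le hxy.le hy.2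
  exact (sub_lt_sub_right hρ _).trans_le (sub_le_sub_left hc _)
end

section
/- For every integer k ≥ 2 and n ≥ 2, there exists a unique λ*_k ∈ (0,1) with μ_{k,1}(λ*_k) = 0; moreover the sequence (λ*_k)_{k≥2} is strictly increasing and converges to 1. -/
open Filter Topology

/-- The quantity `n (1 + l ^ (n - 1)) / (1 - l ^ n)`. -/
noncomputable def boundaryRate (n : ℕ) (l : ℝ) : ℝ := n * (1 + l ^ (n - 1)) / (1 - l ^ n)

/-- The characteristic polynomial in `s`, whose smaller root is the first term of `μ (j + 1) l`. -/
def charGap (n j : ℕ) (l s : ℝ) : ℝ :=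
  (j + n - s) * (j - s * l) - (j + s) * (j + n + s * l) * l ^ (2 * j + n)

/-- The coefficient `C`, with `coth ω` written as `(1 + l ^ (2 α)) / (1 - l ^ (2 α))`. -/
noncomputable def linCoeff (n j : ℕ) (l : ℝ) : ℝ :=
  ((n : ℝ) / 2 + j) * (l + 1) * ((1 + l ^ (2 * j + n)) / (1 - l ^ (2 * j + n))) + (n : ℝ) / 2 * (l - 1)

theorem cosh_div_sinh_neg_mul_log (n j : ℕ) (hj : 1 ≤ j) {l : ℝ} (h0 : 0 < l) (h1 : l < 1) :
    Real.cosh (-((n : ℝ) / 2 + j) * Real.log l) / Real.sinh (-((n : ℝ) / 2 + j) * Real.log l) =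
      (1 + l ^ (2 * j + n)) / (1 - l ^ (2 * j + n)) := by
  have hp : l ^ (2 * j + n) < 1 := pow_lt_one₀ h0.le h1 (by omega)
  set w := -((n : ℝ) / 2 + j) * Real.log l with hw
  have hpw : l ^ (2 * j + n) = Real.exp (-w) * Real.exp (-w) := by
    rw [← Real.exp_add, ← Real.exp_log (pow_pos h0 _), Real.log_pow, hw]
    congr 1
    push_cast
    ring
  have hinv : Real.exp w * Real.exp (-w) = 1 := by rw [← Real.exp_add]; simp
  rw [Real.cosh_eq, Real.sinh_eq]
  rw [hpw] at hp ⊢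
  have hy := Real.exp_pos (-w)
  have hxy : 0 < Real.exp w - Real.exp (-w) := by
    by_contra! h
    nlinarith
  rw [div_eq_div_iff (by linarith) (by linarith)]
  linear_combination -Real.exp (-w) * hinv

/-- The smaller root of a quadratic is characterised by lying below a point where the quadratic is
negative. -/
theorem two_mul_div_add_sqrt_eq_iff {l C D a x : ℝ} (hl : 0 < l) (hC : 0 < C)
    (ha : l * a ^ 2 - C * a + D < 0) :
    2 * D / (C + √(C ^ 2 - 4 * l * D)) = x ↔ l * x ^ 2 - C * x + D = 0 ∧ x < a := by
  have hdisc : (2 * l * a - C) ^ 2 < C ^ 2 - 4 * l * D := by nlinarith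
  have hs0 := Real.sqrt_nonneg (C ^ 2 - 4 * l * D)
  have hs2 := Real.sq_sqrt ((sq_nonneg (2 * l * a - C)).trans hdisc.le)
  set s := √(C ^ 2 - 4 * l * D)
  rw [← hs2] at hdisc
  have habs := abs_lt.mp (abs_lt_of_sq_lt_sq hdisc hs0)
  have hCs : 0 < C + s := by linarith
  rw [div_eq_iff hCs.ne']
  constructor
  · intro h
    have hx : 2 * l * x = C - s := by
      apply mul_right_cancel₀ hCs.ne'
      linear_combination (-2 * l) * h + hs2
    refine ⟨?_, by nlinarith⟩
    have : 4 * l * (l * x ^ 2 - C * x + D) = 0 := by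
      linear_combination (2 * l * x - C - s) * hx + hs2
    simpa [hl.ne'] using this
  · rintro ⟨h, hxa⟩
    have hsq : (2 * l * x - C) ^ 2 = s ^ 2 := by linear_combination 4 * l * h - hs2
    rcases sq_eq_sq_iff_eq_or_eq_neg.mp hsq with h' | h'
    · nlinarith
    · apply mul_left_cancel₀ (mul_pos two_pos hl).ne'
      linear_combination (-(C + s)) * h' + hs2

theorem one_sub_pow_mul_quadratic (n j : ℕ) {l : ℝ} (hp : l ^ (2 * j + n) ≠ 1) (x : ℝ) :
    (1 - l ^ (2 * j + n)) * (l * x ^ 2 - linCoeff n j l * x + (n + j) * j) = charGap n j l x := by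
  have : 1 - l ^ (2 * j + n) ≠ 0 := sub_ne_zero.mpr hp.symm
  unfold linCoeff charGap
  generalize l ^ (2 * j + n) = p at *
  field_simp
  ring

theorem smaller_root_eq_iff (n j : ℕ) (hj : 1 ≤ j) {l x : ℝ} (h0 : 0 < l) (h1 : l < 1) :
    2 * ((n + j) * j) / (linCoeff n j l + √(linCoeff n j l ^ 2 - 4 * l * ((n + j) * j))) = x ↔
      charGap n j l x = 0 ∧ x < j + n := by
  have hj' : (1 : ℝ) ≤ j := by exact_mod_cast hj
  have hn0 : (0 : ℝ) ≤ n := n.cast_nonneg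
  have hp0 : 0 < l ^ (2 * j + n) := pow_pos h0 _
  have hp : l ^ (2 * j + n) < 1 := pow_lt_one₀ h0.le h1 (by omega)
  have hq := one_sub_pow_mul_quadratic n j hp.ne
  have hp' : 0 < 1 - l ^ (2 * j + n) := by linarith
  have hC : 0 < linCoeff n j l := by
    have h : 1 ≤ (1 + l ^ (2 * j + n)) / (1 - l ^ (2 * j + n)) := by
      rw [le_div_iff₀ hp']; linarith
    have h2 := mul_le_mul_of_nonneg_left h (a := ((n : ℝ) / 2 + j) * (l + 1)) (by positivity)
    unfold linCoeff
    nlinarith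
  have ha : l * ((j : ℝ) + n) ^ 2 - linCoeff n j l * (j + n) + (n + j) * j < 0 := by
    refine (pos_iff_neg_of_mul_neg ?_).mp hp'
    rw [hq, charGap, sub_self, zero_mul, zero_sub, neg_lt_zero]
    positivity
  rw [two_mul_div_add_sqrt_eq_iff h0 hC ha, ← hq x]
  simp [hp'.ne']

theorem boundaryRate_pos {n : ℕ} (hn : 2 ≤ n) {l : ℝ} (h0 : 0 < l) (h1 : l < 1) :
    0 < boundaryRate n l := by
  have : l ^ n < 1 := pow_lt_one₀ h0.le h1 (by omega)
  have : (0 : ℝ) < n := by positivity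
  unfold boundaryRate
  exact div_pos (by positivity) (by linarith)

theorem boundaryRate_lt {n : ℕ} (hn : 2 ≤ n) {l l' : ℝ} (h0 : 0 < l) (hl : l < l') (h1 : l' < 1) :
    boundaryRate n l < boundaryRate n l' := by
  have h2 : l' ^ n < 1 := pow_lt_one₀ (h0.trans hl).le h1 (by omega)
  have h3 : l ^ n < l' ^ n := pow_lt_pow_left₀ hl h0.le (by omega)
  have h4 : l ^ (n - 1) < l' ^ (n - 1) := pow_lt_pow_left₀ hl h0.le (by omega)
  have h5 := h0.trans hl
  unfold boundaryRate
  apply div_lt_div₀ _ (by linarith) (by positivity) (by linarith)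
  gcongr

theorem charGap_pos {n j j' : ℕ} {l l' s s' : ℝ} (hl0 : 0 < l) (hl : l ≤ l') (hl1 : l' < 1)
    (hs0 : 0 < s) (hs : s ≤ s') (hj : j' ≤ j) (hsa : s' < j' + n) (hsb : s' * l' < j')
    (hstrict : s < s' ∨ j' < j) (h : 0 ≤ charGap n j' l' s') : 0 < charGap n j l s := by
  have hp : l ^ (2 * j + n) ≤ l' ^ (2 * j' + n) :=
    (pow_le_pow_of_le_one hl0.le (by linarith) (by omega)).trans
      (pow_le_pow_left₀ hl0.le hl _)
  have hp0 : 0 < l ^ (2 * j + n) := pow_pos hl0 _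
  unfold charGap at *
  generalize l ^ (2 * j + n) = p at *
  generalize l' ^ (2 * j' + n) = p' at *
  have hjr : (j' : ℝ) ≤ j := by exact_mod_cast hj
  have hst : s < s' ∨ (j' : ℝ) < j := by exact_mod_cast hstrict
  have hn0 : (0 : ℝ) ≤ n := n.cast_nonneg
  have hl'0 := hl0.trans_le hl
  have hs'0 := hs0.trans_le hs
  have hb' : (0 : ℝ) < j' := (mul_pos hs'0 hl'0).trans hsb
  generalize (j : ℝ) = b at *
  generalize (j' : ℝ) = b' at *
  generalize (n : ℝ) = m at *
  have hsl : s * l ≤ s' * l' := by gcongr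
  have hsl0 : 0 < s * l := by positivity
  have hb : 0 < b := by linarith
  have e1 : (b' + m) * s < (b + m) * s' := by
    rcases hst with h | h
    · nlinarith
    · nlinarith
  have e2 : b' * s ≤ b * s' := by gcongr
  have e3 : b' * (s * l) ≤ b * (s' * l') := by gcongr
  have e4 : (s * l) * (b' + m - s') ≤ (s' * l') * (b + m - s) := by
    apply mul_le_mul hsl (by linarith) (by linarith) (by linarith)
  have e5 : s * s' * l ≤ s * s' * l' := by gcongr
  have hAQ : (b' + m - s') * (b + m + s * l) < (b + m - s) * (b' + m + s' * l') := by nlinarith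
  have hBP : (b' - s' * l') * (b + s) ≤ (b - s * l) * (b' + s') := by nlinarith
  have hA' : 0 < b' + m - s' := by linarith
  have hB : 0 < b - s * l := by linarith
  have hQ : 0 < b + m + s * l := by linarith
  have hQ' : 0 < b' + m + s' * l' := by nlinarith
  have f1 : ((b' + m - s') * (b + m + s * l)) * ((b' - s' * l') * (b + s)) <
      ((b + m - s) * (b' + m + s' * l')) * ((b - s * l) * (b' + s')) :=
    (mul_le_mul_of_nonneg_left hBP (by positivity)).trans_lt
      (mul_lt_mul_of_pos_right hAQ (by positivity))
  have f2 : (b' + s') * (b' + m + s' * l') * p ≤ (b' + m - s') * (b' - s' * l') := by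
    have := mul_le_mul_of_nonneg_left hp (a := (b' + s') * (b' + m + s' * l')) (by positivity)
    linarith
  have f3 := mul_le_mul_of_nonneg_right f2 (a := (b + s) * (b + m + s * l)) (by positivity)
  have hK : 0 < (b' + s') * (b' + m + s' * l') := by positivity
  refine (pos_iff_pos_of_mul_pos (a := (b' + s') * (b' + m + s' * l')) ?_).mp hK
  linarith

/-- Along `boundaryRate`, nonnegativity of `charGap` forces positivity at any smaller point and
larger index. -/
theorem charGap_boundaryRate_pos {n : ℕ} (hn : 2 ≤ n) {j j' : ℕ} {l l' : ℝ} (hl0 : 0 < l)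
    (hl : l ≤ l') (hl1 : l' < 1) (hj : j' ≤ j) (hsa : boundaryRate n l' < j' + n)
    (hsb : boundaryRate n l' * l' < j') (hstrict : l < l' ∨ j' < j)
    (h : 0 ≤ charGap n j' l' (boundaryRate n l')) : 0 < charGap n j l (boundaryRate n l) := by
  refine charGap_pos hl0 hl hl1 (boundaryRate_pos hn hl0 (hl.trans_lt hl1)) ?_ hj hsa hsb
    (hstrict.imp_left fun hlt => boundaryRate_lt hn hl0 hlt hl1) h
  rcases hl.eq_or_lt with rfl | hlt
  · rfl
  · exact (boundaryRate_lt hn hl0 hlt hl1).le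

theorem mul_lt_of_charGap_eq_zero {n j : ℕ} {l s : ℝ} (hl : 0 < l) (hs : 0 < s)
    (h : charGap n j l s = 0) (hsa : s < j + n) : s * l < j := by
  have hA : 0 < (j : ℝ) + n - s := by linarith
  have hprod : 0 < ((j : ℝ) + n - s) * (j - s * l) := by
    rw [charGap, sub_eq_zero] at h
    rw [h]
    positivity
  linarith [(pos_iff_pos_of_mul_pos hprod).mp hA]

theorem exists_charGap_boundaryRate_eq_zero {n j : ℕ} (hn : 2 ≤ n) (hj : 1 ≤ j) :
    ∃ l ∈ Set.Ioo (0 : ℝ) 1, charGap n j l (boundaryRate n l) = 0 ∧ boundaryRate n l < j + n := by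
  have hjr : (1 : ℝ) ≤ j := by exact_mod_cast hj
  have hnr : (2 : ℝ) ≤ n := by exact_mod_cast hn
  set r : ℝ := 1 - 1 / (j + n) with hr
  have hinv : 0 < 1 / ((j : ℝ) + n) := by positivity
  have hinv1 : 1 / ((j : ℝ) + n) < 1 := by rw [div_lt_one (by linarith)]; linarith
  have hr0 : 0 < r := by linarith
  have hr1 : r < 1 := by linarith
  have hrate : (j : ℝ) + n ≤ boundaryRate n r := by
    have hbern : 1 - n * (1 / ((j : ℝ) + n)) ≤ r ^ n := by
      have := one_add_mul_le_pow (a := -(1 / ((j : ℝ) + n))) (by linarith) n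
      rw [hr, sub_eq_add_neg 1 (1 / ((j : ℝ) + n))]
      linarith
    have hrn : r ^ n < 1 := pow_lt_one₀ hr0.le hr1 (by omega)
    have hmul : ((j : ℝ) + n) * (1 - r ^ n) ≤ n := by
      calc ((j : ℝ) + n) * (1 - r ^ n) ≤ (j + n) * (n * (1 / (j + n))) := by
            gcongr; linarith
        _ = n := by field_simp
    rw [boundaryRate, le_div_iff₀ (by linarith)]
    nlinarith [pow_pos hr0 (n - 1)]
  let φ : ℝ → ℝ := fun l => max (j + n - boundaryRate n l) 0 * max (j - boundaryRate n l * l) 0 -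
    (j + boundaryRate n l) * (j + n + boundaryRate n l * l) * l ^ (2 * j + n)
  have hcont : ContinuousOn (boundaryRate n) (Set.Icc 0 r) := by
    unfold boundaryRate
    refine ContinuousOn.div (by fun_prop) (by fun_prop) fun l hl => ?_
    have := pow_lt_one₀ hl.1 (hl.2.trans_lt hr1) (by omega : n ≠ 0)
    linarith
  have hφ : ContinuousOn φ (Set.Icc 0 r) := by fun_prop
  have hφ0 : 0 < φ 0 := by
    have hrate0 : boundaryRate n 0 = n := by
      rw [boundaryRate, zero_pow (by omega), zero_pow (by omega)]
      simp
    have : φ 0 = j * j := by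
      simp only [φ, hrate0]
      rw [zero_pow (by omega)]
      simp
    rw [this]
    positivity
  have hφr : φ r ≤ 0 := by
    have hpos := boundaryRate_pos hn hr0 hr1
    simp only [φ]
    rw [max_eq_right (by linarith), zero_mul, zero_sub, neg_nonpos]
    positivity
  obtain ⟨l, hl, hl0⟩ := intermediate_value_Icc' hr0.le hφ ⟨hφr, hφ0.le⟩
  have hlpos : 0 < l := hl.1.lt_of_ne (by rintro rfl; exact hφ0.ne' hl0)
  have hl1 : l < 1 := hl.2.trans_lt hr1
  have hpos := boundaryRate_pos hn hlpos hl1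
  have hprod : max (j + n - boundaryRate n l) 0 * max (j - boundaryRate n l * l) 0 =
    (j + boundaryRate n l) * (j + n + boundaryRate n l * l) * l ^ (2 * j + n) := sub_eq_zero.mp hl0
  have hprod_pos : 0 < (j + boundaryRate n l) * (j + n + boundaryRate n l * l) * l ^ (2 * j + n) := by
    positivity
  rw [← hprod] at hprod_pos
  have hA : 0 < (j : ℝ) + n - boundaryRate n l := by
    by_contra! h
    simp [max_eq_right h] at hprod_pos
  have hB : 0 < (j : ℝ) - boundaryRate n l * l := by
    by_contra! h
    simp [max_eq_right h] at hprod_pos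
  refine ⟨l, ⟨hlpos, hl1⟩, ?_, by linarith⟩
  rw [charGap, ← hprod, max_eq_left hA.le, max_eq_left hB.le, sub_self]

theorem eventually_charGap_pos (n : ℕ) {l s : ℝ} (hl0 : 0 < l) (hl1 : l < 1) (hs : 0 < s) :
    ∀ᶠ j : ℕ in atTop, s < j + n ∧ s * l < j ∧ 0 < charGap n j l s := by
  have hcast := tendsto_natCast_atTop_atTop (R := ℝ)
  have hgeom : Tendsto (fun j : ℕ => (j : ℝ) ^ 2 * l ^ j) atTop (𝓝 0) :=
    tendsto_pow_const_mul_const_pow_of_abs_lt_one 2 (by rwa [abs_of_pos hl0])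
  filter_upwards [hcast.eventually_ge_atTop (s + n + 1),
    hcast.eventually_ge_atTop (s * l + 1),
    hgeom.eventually_lt_const (by norm_num : (0 : ℝ) < 1 / 6)] with j hj1 hj2 hj3
  have hn0 : (0 : ℝ) ≤ n := n.cast_nonneg
  have hsl : 0 < s * l := by positivity
  refine ⟨by linarith, by linarith, ?_⟩
  have hp : l ^ (2 * j + n) ≤ l ^ j := pow_le_pow_of_le_one hl0.le hl1.le (by omega)
  have hA : (1 : ℝ) ≤ (j + n - s) * (j - s * l) := by nlinarith
  have hP : ((j : ℝ) + s) * (j + n + s * l) ≤ (2 * j) * (3 * j) := by gcongr <;> linarith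
  have : ((j : ℝ) + s) * (j + n + s * l) * l ^ (2 * j + n) ≤ (2 * j) * (3 * j) * l ^ j := by gcongr
  rw [charGap]
  nlinarith

theorem stmt15 (n : ℕ) (hn : 2 ≤ n)
    (μ : ℕ → ℝ → ℝ)
    (hμ : ∀ (k : ℕ) (l : ℝ), μ k l =
      2*((n:ℝ)+k-1)*(k-1) /
        (((n:ℝ)/2+k-1)*(l+1)*(Real.cosh (-((n:ℝ)/2+k-1)*Real.log l) / Real.sinh (-((n:ℝ)/2+k-1)*Real.log l)) + ((n:ℝ)/2)*(l-1)
          + Real.sqrt ((((n:ℝ)/2+k-1)*(l+1)*(Real.cosh (-((n:ℝ)/2+k-1)*Real.log l) / Real.sinh (-((n:ℝ)/2+k-1)*Real.log l))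
              + ((n:ℝ)/2)*(l-1))^2 - 4*l*((n:ℝ)+k-1)*(k-1)))
      - n*(1+l^(n-1))/(1-l^n)) :
    (∀ k : ℕ, 2 ≤ k → ∃! l, l ∈ Set.Ioo (0:ℝ) 1 ∧ μ k l = 0) ∧
    ∀ Λ : ℕ → ℝ, (∀ k : ℕ, 2 ≤ k → Λ k ∈ Set.Ioo (0:ℝ) 1 ∧ μ k (Λ k) = 0) →
      (∀ k : ℕ, 2 ≤ k → Λ k < Λ (k+1)) ∧ Filter.Tendsto Λ Filter.atTop (nhds 1) := by
  have key : ∀ j : ℕ, 1 ≤ j → ∀ l ∈ Set.Ioo (0 : ℝ) 1,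
      (μ (j + 1) l = 0 ↔ charGap n j l (boundaryRate n l) = 0 ∧ boundaryRate n l < j + n) := by
    intro j hj l hl
    rw [← smaller_root_eq_iff n j hj hl.1 hl.2, hμ, sub_eq_zero]
    have hα : (n : ℝ) / 2 + (j + 1 : ℕ) - 1 = n / 2 + j := by push_cast; ring
    have ha : (n : ℝ) + (j + 1 : ℕ) - 1 = n + j := by push_cast; ring
    have hb : ((j + 1 : ℕ) : ℝ) - 1 = j := by push_cast; ring
    rw [hα, ha, hb, cosh_div_sinh_neg_mul_log n j hj hl.1 hl.2, mul_assoc 2 _ (j : ℝ),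
      mul_assoc (4 * l) _ (j : ℝ)]
    rfl
  have ordered : ∀ j j' : ℕ, ∀ l ∈ Set.Ioo (0 : ℝ) 1, ∀ l' ∈ Set.Ioo (0 : ℝ) 1, 1 ≤ j' → j' ≤ j →
      μ (j + 1) l = 0 → μ (j' + 1) l' = 0 → l ≤ l' → ¬ (l < l' ∨ j' < j) := by
    intro j j' l hl l' hl' hj' hj h h' hle hstrict
    obtain ⟨h1, -⟩ := (key j (hj'.trans hj) l hl).mp h
    obtain ⟨h1', h2'⟩ := (key j' hj' l' hl').mp h'
    have hb := mul_lt_of_charGap_eq_zero hl'.1 (boundaryRate_pos hn hl'.1 hl'.2) h1' h2'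
    exact (charGap_boundaryRate_pos hn hl.1 hle hl'.2 hj h2' hb hstrict h1'.ge).ne' h1
  refine ⟨fun k hk => ?_, fun Λ hΛ => ⟨fun k hk => ?_, ?_⟩⟩
  · obtain ⟨j, rfl⟩ : ∃ j, k = j + 1 := ⟨k - 1, by omega⟩
    have hj : 1 ≤ j := by omega
    obtain ⟨l, hl, hz⟩ := exists_charGap_boundaryRate_eq_zero hn hj
    have hμl := (key j hj l hl).mpr hz
    refine ⟨l, ⟨hl, hμl⟩, fun l' ⟨hl', hμl'⟩ => ?_⟩
    rcases lt_trichotomy l' l with h | h | h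
    · exact absurd (Or.inl h) (ordered j j l' hl' l hl hj le_rfl hμl' hμl h.le)
    · exact h
    · exact absurd (Or.inl h) (ordered j j l hl l' hl' hj le_rfl hμl hμl' h.le)
  · obtain ⟨j, rfl⟩ : ∃ j, k = j + 1 := ⟨k - 1, by omega⟩
    obtain ⟨hm, hz⟩ := hΛ _ hk
    obtain ⟨hm', hz'⟩ := hΛ (j + 1 + 1) (by omega)
    by_contra! hle
    exact ordered (j + 1) j _ hm' _ hm (by omega) (by omega) hz' hz hle (Or.inr j.lt_succ_self)
  · rw [← tendsto_add_atTop_iff_nat 1]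
    refine tendsto_order.mpr ⟨fun c hc => ?_, fun c hc => ?_⟩
    · obtain ⟨l, hl, hl1⟩ := exists_between (max_lt hc one_pos)
      have hl0 : 0 < l := (le_max_right _ _).trans_lt hl
      filter_upwards [eventually_charGap_pos n hl0 hl1 (boundaryRate_pos hn hl0 hl1),
        eventually_ge_atTop 1] with j ⟨hsa, hsb, hpos⟩ hj
      obtain ⟨hm, hz⟩ := hΛ (j + 1) (by omega)
      have hgap := ((key j hj _ hm).mp hz).1
      refine ((le_max_left _ _).trans_lt hl).trans ?_
      by_contra! hle
      rcases hle.eq_or_lt with heq | hlt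
      · rw [heq] at hgap
        exact hpos.ne' hgap
      · exact (charGap_boundaryRate_pos hn hm.1 hle hl1 le_rfl hsa hsb (Or.inl hlt) hpos.le).ne'
          hgap
    · filter_upwards [eventually_ge_atTop 1] with j hj
      exact (hΛ (j + 1) (by omega)).1.2.trans hc
end
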